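/- Let R = (V, Z, O, r) be an instance over the Horn template Γ = ({0,1}, {(0)}, {(1)}, ϱ_{x∧y→z}), and let R' = (V, Z', O', r') be the densification of (R, Γ), i.e. the unique maximal instance with Z' ⊇ Z, O' ⊇ O, r' ⊇ r and Hom(R', Γ) = Hom(R, Γ). Then for all i, j, k ∈ V with Z ∩ o_Σ({i, j} ∪ O) = ∅, one has (i, j, k) ∈ r' if and only if k ∈ o_Σ({i, j} ∪ O). -/

import Mathlib

/-- Homomorphisms from the instance `(V, Z, O, r)` to the Horn template
`({0,1}, {(0)}, {(1)}, ϱ_{x∧y→z})`. -/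
def HornHom {V : Type*} (Z O : Set V) (r : Set (V × V × V)) : Set (V → Bool) :=
  {h | (∀ v ∈ Z, h v = false) ∧ (∀ v ∈ O, h v = true) ∧
       ∀ c ∈ r, (h c.1 && h c.2.1) ≤ h c.2.2}

/-- The closure `o_Σ(S)`: the smallest `T ⊇ S` such that `(i,j,k) ∈ r` and `i, j ∈ T`
imply `k ∈ T`. -/
def hornClosure {V : Type*} (r : Set (V × V × V)) (S : Set V) : Set V :=
  ⋂₀ {T : Set V | S ⊆ T ∧ ∀ i j k : V, (i, j, k) ∈ r → i ∈ T → j ∈ T → k ∈ T}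

/-- The closure lies in every superset of the generators that is closed under the rules. -/
theorem hornClosure_subset {V : Type*} {r : Set (V × V × V)} {S T : Set V} (hS : S ⊆ T)
    (hT : ∀ i j k : V, (i, j, k) ∈ r → i ∈ T → j ∈ T → k ∈ T) : hornClosure r S ⊆ T :=
  Set.sInter_subset_of_mem ⟨hS, hT⟩

theorem subset_hornClosure {V : Type*} (r : Set (V × V × V)) (S : Set V) :
    S ⊆ hornClosure r S :=
  Set.subset_sInter fun _ hT => hT.1

theorem hornClosure_closed {V : Type*} {r : Set (V × V × V)} {S : Set V} {i j k : V}
    (hr : (i, j, k) ∈ r) (hi : i ∈ hornClosure r S) (hj : j ∈ hornClosure r S) :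
    k ∈ hornClosure r S :=
  fun T hT => hT.2 i j k hr (hi T hT) (hj T hT)

theorem mem_hornHom_iff {V : Type*} {Z O : Set V} {r : Set (V × V × V)} {h : V → Bool} :
    h ∈ HornHom Z O r ↔ (∀ v ∈ Z, h v = false) ∧ (∀ v ∈ O, h v = true) ∧
      ∀ i j k : V, (i, j, k) ∈ r → h i = true → h j = true → h k = true := by
  simp [HornHom, Prod.forall, Bool.le_iff_imp]

open Classical in
/-- The indicator of a closure containing `O` and disjoint from `Z` is a homomorphism. -/
theorem indicator_hornClosure_mem_hornHom {V : Type*} {Z O S : Set V} {r : Set (V × V × V)}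
    (hO : O ⊆ S) (hZ : Z ∩ hornClosure r S = ∅) :
    (fun v => decide (v ∈ hornClosure r S)) ∈ HornHom Z O r := by
  simp only [mem_hornHom_iff, decide_eq_true_eq, decide_eq_false_iff_not]
  exact ⟨fun v hv hc => (hZ ▸ Set.mem_inter hv hc : v ∈ (∅ : Set V)),
    fun v hv => subset_hornClosure r S (hO hv), fun _ _ _ => hornClosure_closed⟩

/-- A homomorphism that is true on `S` is true on the closure of `S`. -/
theorem eq_true_of_mem_hornClosure {V : Type*} {Z O S : Set V} {r : Set (V × V × V)}
    {h : V → Bool} (hh : h ∈ HornHom Z O r) (hS : ∀ v ∈ S, h v = true) {k : V}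
    (hk : k ∈ hornClosure r S) : h k = true :=
  hornClosure_subset (T := {v | h v = true}) hS (mem_hornHom_iff.1 hh).2.2 hk

/-- If `(V, Z', O', r')` is the densification of `(V, Z, O, r)` over the Horn template,
then for all `i, j, k` with `Z ∩ o_Σ({i,j} ∪ O) = ∅`:
`(i,j,k) ∈ r'` iff `k ∈ o_Σ({i,j} ∪ O)`. -/
theorem stmt11 {V : Type*} (Z O : Set V) (r : Set (V × V × V))
    (Z' O' : Set V) (r' : Set (V × V × V))
    (hZ : Z ⊆ Z') (hO : O ⊆ O') (hr : r ⊆ r')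
    (hHom : HornHom Z' O' r' = HornHom Z O r)
    (hMax : ∀ (Z'' O'' : Set V) (r'' : Set (V × V × V)),
      Z' ⊆ Z'' → O' ⊆ O'' → r' ⊆ r'' →
      HornHom Z'' O'' r'' = HornHom Z' O' r' → Z'' = Z' ∧ O'' = O' ∧ r'' = r')
     :
    ∀ i j k : V, Z ∩ hornClosure r (insert i (insert j O)) = ∅ →
      ((i, j, k) ∈ r' ↔ k ∈ hornClosure r (insert i (insert j O))) := by
  intro i j k hdisj
  constructor
  · intro hk
    have hmem := indicator_hornClosure_mem_hornHom
      ((Set.subset_insert j O).trans (Set.subset_insert i _)) hdisj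
    simp only [← hHom, mem_hornHom_iff, decide_eq_true_eq] at hmem
    exact hmem.2.2 i j k hk (subset_hornClosure r _ (by simp)) (subset_hornClosure r _ (by simp))
  · intro hk
    have hinsert : HornHom Z' O' (insert (i, j, k) r') = HornHom Z' O' r' := by
      ext h
      refine ⟨fun hh => ⟨hh.1, hh.2.1, fun c hc => hh.2.2 c (Set.mem_insert_of_mem _ hc)⟩,
        fun hh => ?_⟩
      obtain ⟨hZ', hO', hr'⟩ := mem_hornHom_iff.1 hh
      refine mem_hornHom_iff.2 ⟨hZ', hO', fun a b c habc ha hb => ?_⟩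
      rcases habc with heq | habc
      · obtain ⟨rfl, rfl, rfl⟩ : a = i ∧ b = j ∧ c = k := by simpa using heq
        refine eq_true_of_mem_hornClosure (hHom ▸ hh) ?_ hk
        rintro v (rfl | rfl | hv)
        exacts [ha, hb, hO' v (hO hv)]
      · exact hr' a b c habc ha hb
    rw [← (hMax Z' O' _ subset_rfl subset_rfl (Set.subset_insert _ _) hinsert).2.2]
    exact Set.mem_insert _ _
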